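/- Let ω′ ⊂ Ĵ be an interval, s ≥ 1, and let 0 ≤ ν₁ < ν₂ < … < ν_s be integers with associated integers r₁, …, r_s ≥ 1 such that f^{ν_s} is a diffeomorphism on ω′ and: (i) |f^{ν_s}(ω′)| ≤ e^{−r_s}; (ii) |(f^{ν₁})′(x)| ≥ κ for all x ∈ ω′; and (iii) for each i = 1, …, s−1 and every x ∈ ω′, |(f^{ν_{i+1} − ν_i})′(f^{ν_i}(x))| ≥ e^{θ r_i}, where θ > 0 and κ > 0 are constants. Then |ω′| ≤ κ⁻¹ e^{−θ R} where R = r₁ + ⋯ + r_s (using θ ≤ 1 so that e^{−r_s} ≤ e^{−θ r_s}). -/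

import Mathlib

open Set MeasureTheory Filter Topology

noncomputable section

/-- Chain rule for a composite of two iterates: lower bounds on the derivatives multiply.
Positivity of the bounds forces differentiability. -/
theorem differentiableAt_iterate_and_mul_le_abs_deriv {f : ℝ → ℝ} {m n : ℕ} (hmn : m ≤ n)
    {x a b : ℝ} (ha : 0 < a) (hb : 0 < b) (hm : a ≤ |deriv (f^[m]) x|)
    (hn : b ≤ |deriv (f^[n - m]) (f^[m] x)|) :
    DifferentiableAt ℝ (f^[n]) x ∧ a * b ≤ |deriv (f^[n]) x| := by
  have hdm : DifferentiableAt ℝ (f^[m]) x :=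
    differentiableAt_of_deriv_ne_zero (abs_pos.mp (ha.trans_le hm))
  have hdn : DifferentiableAt ℝ (f^[n - m]) (f^[m] x) :=
    differentiableAt_of_deriv_ne_zero (abs_pos.mp (hb.trans_le hn))
  have hcomp : f^[n] = f^[n - m] ∘ f^[m] := by
    rw [← Function.iterate_add, Nat.sub_add_cancel hmn]
  rw [hcomp]
  refine ⟨hdn.comp x hdm, ?_⟩
  rw [deriv_comp x hdn hdm, abs_mul, mul_comm a b]
  exact mul_le_mul hn hm ha.le (abs_nonneg _)

/-- An injective map expanding by at least `C` on a measurable set expands its measure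
by at least `C`. -/
theorem ofReal_mul_volume_le_volume_image {g : ℝ → ℝ} {S : Set ℝ} (hS : MeasurableSet S)
    (hinj : InjOn g S) {C : ℝ} (hd : ∀ x ∈ S, DifferentiableAt ℝ g x)
    (hC : ∀ x ∈ S, C ≤ |deriv g x|) :
    ENNReal.ofReal C * volume S ≤ volume (g '' S) := by
  have key := lintegral_image_eq_lintegral_abs_deriv_mul hS
    (fun x hx => (hd x hx).hasDerivAt.hasDerivWithinAt) hinj (fun _ => 1)
  simp only [mul_one, setLIntegral_one] at key
  rw [key, ← setLIntegral_const]
  exact setLIntegral_mono' hS fun x hx => ENNReal.ofReal_le_ofReal (hC x hx)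

/-- **Lemma (metric estimate for escaping components).** Let `ω′ ⊂ Ĵ` be an interval
with essential return times `ν₁ < … < ν_s` and return depths `r₁, …, r_s ≥ 1` such that
`f^{ν_s}` is a diffeomorphism on `ω′`, `|f^{ν_s}(ω′)| ≤ e^{−r_s}`, `|(f^{ν₁})′| ≥ κ` on
`ω′`, and `|(f^{ν_{i+1}−ν_i})′(f^{ν_i}x)| ≥ e^{θ r_i}` for `1 ≤ i < s`. Then
`|ω′| ≤ κ⁻¹ e^{−θR}` where `R = r₁ + ⋯ + r_s` (using `θ ≤ 1`). -/
theorem metric_escape_estimate (f : ℝ → ℝ) (Jhat : Set ℝ) (hinv : f ⁻¹' Jhat = Jhat)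
    (κ θ : ℝ) (hκ : 0 < κ) (hθ : 0 < θ) (hθ1 : θ ≤ 1)
    (ω' : Set ℝ) (hsub : ω' ⊆ Jhat) (hconn : ω'.OrdConnected) (hne : ω'.Nonempty)
    (s : ℕ) (hs : 1 ≤ s) (ν r : ℕ → ℕ)
    (hr : ∀ i : ℕ, 1 ≤ i → i ≤ s → 1 ≤ r i)
    (hmono : ∀ i : ℕ, 1 ≤ i → i < s → ν i < ν (i + 1))
    (hinj : Set.InjOn (f^[ν s]) ω')
    (hdiff : DifferentiableOn ℝ (f^[ν s]) ω')
    (hlast : volume (f^[ν s] '' ω') ≤ ENNReal.ofReal (Real.exp (-(r s : ℝ))))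
    (hfirst : ∀ x ∈ ω', κ ≤ |deriv (f^[ν 1]) x|)
    (hret : ∀ i : ℕ, 1 ≤ i → i < s → ∀ x ∈ ω',
      Real.exp (θ * r i) ≤ |deriv (f^[ν (i + 1) - ν i]) (f^[ν i] x)|) :
    volume ω' ≤
      ENNReal.ofReal (κ⁻¹ * Real.exp (-θ * ∑ i ∈ Finset.Icc 1 s, (r i : ℝ))) := by
  have hchain : ∀ x ∈ ω', ∀ k, 1 ≤ k → k ≤ s → DifferentiableAt ℝ (f^[ν k]) x ∧
      κ * Real.exp (θ * ∑ i ∈ Finset.Ico 1 k, (r i : ℝ)) ≤ |deriv (f^[ν k]) x| := by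
    intro x hx k hk
    induction k, hk using Nat.le_induction with
    | base =>
      intro _
      refine ⟨differentiableAt_of_deriv_ne_zero (abs_pos.mp (hκ.trans_le (hfirst x hx))), ?_⟩
      simpa using hfirst x hx
    | succ k hk ih =>
      intro hks
      have h := differentiableAt_iterate_and_mul_le_abs_deriv (hmono k hk hks).le
        (by positivity) (Real.exp_pos _) (ih (by omega)).2 (hret k hk hks x hx)
      rwa [mul_assoc, ← Real.exp_add, ← mul_add, ← Finset.sum_Ico_succ_top hk] at h
  set T := ∑ i ∈ Finset.Ico 1 s, (r i : ℝ)
  have hsum : ∑ i ∈ Finset.Icc 1 s, (r i : ℝ) = T + r s := by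
    rw [← Finset.sum_Ico_succ_top hs]
    rfl
  have hC : 0 < κ * Real.exp (θ * T) := by positivity
  have hvol := (ofReal_mul_volume_le_volume_image hconn.measurableSet hinj
    (fun x hx => (hchain x hx s hs le_rfl).1)
    (fun x hx => (hchain x hx s hs le_rfl).2)).trans hlast
  have hdiv : volume ω' ≤
      ENNReal.ofReal (Real.exp (-(r s : ℝ)) / (κ * Real.exp (θ * T))) := by
    rw [ENNReal.ofReal_div_of_pos hC, ENNReal.le_div_iff_mul_le
      (Or.inl (ENNReal.ofReal_pos.mpr hC).ne') (Or.inl ENNReal.ofReal_ne_top), mul_comm]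
    exact hvol
  refine hdiv.trans (ENNReal.ofReal_le_ofReal ?_)
  rw [hsum, div_eq_inv_mul, mul_inv, ← Real.exp_neg, mul_assoc, ← Real.exp_add]
  gcongr
  nlinarith [mul_le_mul_of_nonneg_right hθ1 (Nat.cast_nonneg (α := ℝ) (r s))]
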